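/- In the polar dual of a four-dimensional short top, any edge containing the point (0,0,0,-1) in its interior contains exactly 3 lattice points. -/

import Mathlib

open Finset Matrix Pointwise
open scoped Classical

noncomputable section

namespace SemistableTops

/-- A point of `ℝ^k` with all integer coordinates. -/
def IsLatticePt {k : ℕ} (x : Fin k → ℝ) : Prop := ∀ i, ∃ n : ℤ, x i = (n : ℝ)

/-- The lattice points lying in a subset of `ℝ^k`. -/
def latticePts {k : ℕ} (S : Set (Fin k → ℝ)) : Set (Fin k → ℝ) := {x ∈ S | IsLatticePt x}

/-- The polar dual `{y : x ⬝ y ≥ -1 for all x ∈ S}`. -/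
def polarDual {k : ℕ} (S : Set (Fin k → ℝ)) : Set (Fin k → ℝ) :=
  {y | ∀ x ∈ S, -1 ≤ ∑ i, x i * y i}

/-- A lattice polytope: the convex hull of finitely many lattice points. -/
def IsLatticePolytope {k : ℕ} (S : Set (Fin k → ℝ)) : Prop :=
  ∃ V : Finset (Fin k → ℝ), (∀ v ∈ V, IsLatticePt v) ∧ S = convexHull ℝ (V : Set (Fin k → ℝ))

/-- A reflexive polytope: a lattice polytope containing the origin whose polar dual is
again a lattice polytope. -/
def IsReflexive {k : ℕ} (S : Set (Fin k → ℝ)) : Prop :=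
  IsLatticePolytope S ∧ (0 : Fin k → ℝ) ∈ S ∧ IsLatticePolytope (polarDual S)

/-- `F` is a `d`-dimensional exposed face of `P`, cut out by a supporting hyperplane. -/
def IsFace {k : ℕ} (P F : Set (Fin k → ℝ)) (d : ℕ) : Prop :=
  ∃ (n : Fin k → ℝ) (c : ℝ), n ≠ 0 ∧ (∀ x ∈ P, c ≤ ∑ i, n i * x i) ∧
    F = {x ∈ P | ∑ i, n i * x i = c} ∧
    Module.finrank ℝ (affineSpan ℝ F).direction = d

/-- Forget the last coordinate. -/
def projInit {k : ℕ} (x : Fin (k+1) → ℝ) : Fin k → ℝ := fun i => x i.castSucc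

/-- The last coordinate. -/
def lastCoord {k : ℕ} (x : Fin (k+1) → ℝ) : ℝ := x (Fin.last k)

/-- The point `(0, …, 0, -1)`. -/
def negE (k : ℕ) : Fin (k+1) → ℝ := fun i => if i = Fin.last k then -1 else 0

/-- A `(k+1)`-dimensional top: a lattice polytope in the half-space `x_{k+1} ≥ 0`, whose
facet in the hyperplane `x_{k+1} = 0` is a `k`-dimensional reflexive polytope, and whose
other facets lie on hyperplanes `n ⬝ x = -1` with `n` a lattice point. -/
structure IsTopPoly {k : ℕ} (Δ : Set (Fin (k+1) → ℝ)) : Prop where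
  poly : IsLatticePolytope Δ
  halfspace : ∀ x ∈ Δ, 0 ≤ lastCoord x
  facets : ∃ N : Finset (Fin (k+1) → ℝ), (∀ n ∈ N, IsLatticePt n) ∧
      Δ = {x | 0 ≤ lastCoord x} ∩ ⋂ n ∈ N, {x | -1 ≤ ∑ i, n i * x i}
  reflexive_boundary : IsReflexive (projInit '' (Δ ∩ {x | lastCoord x = 0}))

/-- The summit of a top: its intersection with the half-space `x_{k+1} ≥ 1`. -/
def summit {k : ℕ} (Δ : Set (Fin (k+1) → ℝ)) : Set (Fin (k+1) → ℝ) :=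
  Δ ∩ {x | 1 ≤ lastCoord x}

/-- A short top: a top all of whose summit lattice points lie at height `1`. -/
def IsShortTop {k : ℕ} (Δ : Set (Fin (k+1) → ℝ)) : Prop :=
  IsTopPoly Δ ∧ ∀ x ∈ latticePts (summit Δ), lastCoord x = 1

/-- A lattice-preserving linear isomorphism of `ℝ^k` (an element of `GL_k(ℤ)`). -/
def UnimodularMap {k : ℕ} (φ : (Fin k → ℝ) → (Fin k → ℝ)) : Prop :=
  ∃ M : Matrix (Fin k) (Fin k) ℤ, IsUnit M.det ∧
    ∀ x, φ x = (M.map (fun z : ℤ => (z : ℝ))).mulVec x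

/-- The vertical ray `{t • e_{k+1} : t ≥ 0}`. -/
def upRay (n : ℕ) : Set (Fin (n+1) → ℝ) :=
  {x | ∃ t : ℝ, 0 ≤ t ∧ x = fun i => if i = Fin.last n then t else 0}

lemma mem_polarDual {k : ℕ} {S : Set (Fin k → ℝ)} {y : Fin k → ℝ} :
    y ∈ polarDual S ↔ ∀ x ∈ S, -1 ≤ x ⬝ᵥ y := Iff.rfl

lemma convex_le_dotProduct {k : ℕ} (x : Fin k → ℝ) (c : ℝ) : Convex ℝ {y | c ≤ x ⬝ᵥ y} := by
  intro y hy z hz a b ha hb hab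
  simp only [Set.mem_ofPred_eq, dotProduct_add, dotProduct_smul, smul_eq_mul] at *
  calc c = a * c + b * c := by rw [← add_mul, hab, one_mul]
    _ ≤ _ := add_le_add (mul_le_mul_of_nonneg_left hy ha) (mul_le_mul_of_nonneg_left hz hb)

lemma convex_polarDual {k : ℕ} (S : Set (Fin k → ℝ)) : Convex ℝ (polarDual S) := by
  intro y hy z hz a b ha hb hab x hx
  exact convex_le_dotProduct x (-1) (hy x hx) (hz x hx) ha hb hab

lemma isClosed_polarDual {k : ℕ} (S : Set (Fin k → ℝ)) : IsClosed (polarDual S) := by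
  have : polarDual S = ⋂ x ∈ S, {y | -1 ≤ ∑ i, x i * y i} := by
    ext y; simp [polarDual]
  rw [this]
  exact isClosed_biInter fun x _ => isClosed_le continuous_const (by fun_prop)

lemma convexHull_subset_le_dotProduct {k : ℕ} {V : Set (Fin k → ℝ)} {y : Fin k → ℝ} {c : ℝ}
    (h : ∀ v ∈ V, c ≤ v ⬝ᵥ y) : ∀ x ∈ convexHull ℝ V, c ≤ x ⬝ᵥ y := by
  have : convexHull ℝ V ⊆ {x | c ≤ y ⬝ᵥ x} :=
    convexHull_min (fun v hv => by simpa [dotProduct_comm] using h v hv)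
      (convex_le_dotProduct y c)
  intro x hx
  simpa [dotProduct_comm] using this hx

lemma mem_upRay {k : ℕ} {x : Fin (k+1) → ℝ} :
    x ∈ upRay k ↔ ∃ t : ℝ, 0 ≤ t ∧ x = t • Pi.single (Fin.last k) 1 := by
  have (t : ℝ) : (fun i => if i = Fin.last k then t else 0) =
      t • (Pi.single (Fin.last k) 1 : Fin (k+1) → ℝ) := by
    ext i; simp [Pi.single_apply]
  simp [upRay, this]

lemma isClosed_upRay (k : ℕ) : IsClosed (upRay k) := by
  have : upRay k = {x | 0 ≤ x (Fin.last k)} ∩ ⋂ i, {x | i = Fin.last k ∨ x i = 0} := by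
    ext x
    simp only [upRay, Set.mem_ofPred_eq, Set.mem_inter_iff, Set.mem_iInter]
    constructor
    · rintro ⟨t, ht, rfl⟩
      refine ⟨by simpa using ht, fun i => ?_⟩
      by_cases hi : i = Fin.last k <;> simp [hi]
    · rintro ⟨h0, h⟩
      refine ⟨_, h0, ?_⟩
      ext i
      by_cases hi : i = Fin.last k
      · simp [hi]
      · simpa [hi] using h i
  rw [this]
  refine (isClosed_le continuous_const (continuous_apply _)).inter (isClosed_iInter fun i => ?_)
  by_cases hi : i = Fin.last k
  · simp [hi]
  · simpa [hi] using isClosed_eq (continuous_apply i) continuous_const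

lemma convex_upRay (k : ℕ) : Convex ℝ (upRay k) := by
  intro x hx y hy a b ha hb _
  obtain ⟨s, hs, rfl⟩ := mem_upRay.1 hx
  obtain ⟨t, ht, rfl⟩ := mem_upRay.1 hy
  exact mem_upRay.2 ⟨a * s + b * t, by positivity, by simp [add_smul, mul_smul]⟩

/-- The polar dual of a half-space presentation is generated by the normals and the ray. -/
lemma polarDual_subset_convexHull_add_upRay {k : ℕ} {T : Set (Fin (k+1) → ℝ)}
    {N : Finset (Fin (k+1) → ℝ)}
    (hT : T = {x | 0 ≤ lastCoord x} ∩ ⋂ n ∈ N, {x | -1 ≤ ∑ i, n i * x i}) :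
    polarDual T ⊆ convexHull ℝ (insert 0 (N : Set (Fin (k+1) → ℝ))) + upRay k := by
  intro y hy
  by_contra hyC
  have hfin : (insert 0 (N : Set (Fin (k+1) → ℝ))).Finite := N.finite_toSet.insert 0
  have hcl : IsClosed (convexHull ℝ (insert 0 (N : Set (Fin (k+1) → ℝ))) + upRay k) :=
    (isClosed_upRay k).add_left_of_isCompact (hfin.isCompact_convexHull ℝ)
  obtain ⟨f, u, hfy, hf⟩ := geometric_hahn_banach_point_closed
    ((convex_convexHull ℝ _).add (convex_upRay k)) hcl hyC
  have hray (t : ℝ) (ht : 0 ≤ t) : t • Pi.single (Fin.last k) 1 ∈ upRay k :=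
    mem_upRay.2 ⟨t, ht, rfl⟩
  have hmem (z) (hz : z ∈ insert 0 (N : Set (Fin (k+1) → ℝ))) (t : ℝ) (ht : 0 ≤ t) :
      u < f z + t * f (Pi.single (Fin.last k) 1) := by
    have := hf _ (Set.add_mem_add (subset_convexHull ℝ _ hz) (hray t ht))
    simpa using this
  have hu : u < 0 := by simpa using hmem 0 (by simp) 0 le_rfl
  set x : Fin (k+1) → ℝ := fun i => (-u)⁻¹ * f (Pi.single i 1) with hx
  have hdot (z : Fin (k+1) → ℝ) : x ⬝ᵥ z = (-u)⁻¹ * f z := by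
    have h2 : f z = ∑ i, z i * f (Pi.single i 1) := by
      conv_lhs => rw [pi_eq_sum_univ' z]
      simp [map_sum]
    rw [h2, Finset.mul_sum]
    exact Finset.sum_congr rfl fun i _ => by simp [hx]; ring
  have hpos : 0 < (-u)⁻¹ := inv_pos.2 (by linarith)
  have hone : (-u)⁻¹ * u = -1 := by
    rw [inv_neg, neg_mul, inv_mul_cancel₀ hu.ne]
  have hxT : x ∈ T := by
    rw [hT]
    refine ⟨?_, ?_⟩
    · refine mul_nonneg hpos.le ?_
      by_contra! hneg
      have := hmem 0 (by simp) (u / f (Pi.single (Fin.last k) 1))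
        (div_nonneg_of_nonpos hu.le hneg.le)
      rw [div_mul_cancel₀ _ hneg.ne] at this
      simp at this
    · simp only [Set.mem_iInter]
      intro n hn
      have := hmem n (by simp [hn]) 0 le_rfl
      change -1 ≤ n ⬝ᵥ x
      rw [dotProduct_comm, hdot, ← hone]
      exact mul_le_mul_of_nonneg_left (by linarith) hpos.le
  have := hy x hxT
  change -1 ≤ x ⬝ᵥ y at this
  rw [hdot, ← hone] at this
  linarith [mul_lt_mul_of_pos_left hfy hpos]

/-- Extreme points of the dual of a top are lattice points. -/
lemma isLatticePt_of_mem_extremePoints_polarDual {k : ℕ} {T : Set (Fin (k+1) → ℝ)}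
    {N : Finset (Fin (k+1) → ℝ)} (hN : ∀ n ∈ N, IsLatticePt n)
    (hT : T = {x | 0 ≤ lastCoord x} ∩ ⋂ n ∈ N, {x | -1 ≤ ∑ i, n i * x i})
    {y : Fin (k+1) → ℝ} (hy : y ∈ (polarDual T).extremePoints ℝ) : IsLatticePt y := by
  have hgen : insert 0 (N : Set (Fin (k+1) → ℝ)) ⊆ polarDual T := by
    rintro n (rfl | hn) x hx
    · simp
    · rw [hT] at hx
      have := Set.mem_iInter₂.1 hx.2 n hn
      simpa [mul_comm] using this
  have hconv : convexHull ℝ (insert 0 (N : Set (Fin (k+1) → ℝ))) ⊆ polarDual T :=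
    convexHull_min hgen (convex_polarDual T)
  obtain ⟨z, hz, r, hr, rfl⟩ := Set.mem_add.1 (polarDual_subset_convexHull_add_upRay hT hy.1)
  have hadd : z + (2 : ℝ) • r ∈ polarDual T := by
    obtain ⟨t, ht, rfl⟩ := mem_upRay.1 hr
    intro x hx
    have h1 := mem_polarDual.1 (hconv hz) x hx
    have h2 : 0 ≤ x (Fin.last k) := by rw [hT] at hx; exact hx.1
    change -1 ≤ x ⬝ᵥ _
    simp only [dotProduct_add, dotProduct_smul, dotProduct_single, smul_eq_mul, mul_one]
    nlinarith [mul_nonneg ht h2]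
  have hzr : z = z + r := hy.2 (hconv hz) hadd
    ⟨1/2, 1/2, by norm_num, by norm_num, by norm_num, by module⟩
  rw [← hzr] at hy ⊢
  have : z ∈ (convexHull ℝ (insert 0 (N : Set (Fin (k+1) → ℝ)))).extremePoints ℝ :=
    ⟨hz, fun a ha b hb hab => hy.2 (hconv ha) (hconv hb) hab⟩
  rcases extremePoints_convexHull_subset this with rfl | h
  · exact fun i => ⟨0, by simp⟩
  · exact hN z h

/-- A reflexive polytope has bounded polar dual, hence no ray. -/
lemma eq_zero_of_forall_smul_mem_polarDual {k : ℕ} {S : Set (Fin k → ℝ)} (hS : IsReflexive S)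
    {v : Fin k → ℝ} (hv : ∀ s : ℝ, 0 ≤ s → s • v ∈ polarDual S) : v = 0 := by
  obtain ⟨W, -, hW⟩ := hS.2.2
  have hb : Bornology.IsBounded (polarDual S) := by
    rw [hW]
    exact (W.finite_toSet.isCompact_convexHull ℝ).isBounded
  obtain ⟨R, hR⟩ := hb.exists_norm_le
  by_contra hne
  have hpos : 0 < ‖v‖ := norm_pos_iff.2 hne
  have hs : 0 ≤ (|R| + 1) / ‖v‖ := by positivity
  have := hR _ (hv _ hs)
  rw [norm_smul, Real.norm_of_nonneg hs, div_mul_cancel₀ _ hpos.ne'] at this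
  linarith [le_abs_self R]

/-- The only lattice point of the dual of a reflexive polytope off its boundary is the origin. -/
lemma eq_zero_of_isLatticePt_of_smul_mem_polarDual {k : ℕ} {S : Set (Fin k → ℝ)}
    (hS : IsReflexive S) {v : Fin k → ℝ} (hv : IsLatticePt v) {c : ℝ} (hc : 1 < c)
    (hcv : c • v ∈ polarDual S) : v = 0 := by
  refine eq_zero_of_forall_smul_mem_polarDual hS fun s hs => ?_
  obtain ⟨V, hV, hSV⟩ := hS.1
  have key : ∀ x ∈ S, 0 ≤ x ⬝ᵥ v := by
    rw [hSV]
    refine convexHull_subset_le_dotProduct fun x hx => ?_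
    have h1 := mem_polarDual.1 hcv x (hSV ▸ subset_convexHull ℝ _ hx)
    rw [dotProduct_smul, smul_eq_mul] at h1
    choose a ha using hV x hx
    choose b hb using hv
    have hab : x ⬝ᵥ v = ((∑ i, a i * b i : ℤ) : ℝ) := by
      simp [dotProduct, ha, hb]
    rw [hab] at h1 ⊢
    by_contra! hneg
    have : ((∑ i, a i * b i : ℤ) : ℝ) ≤ -1 := by
      have : (∑ i, a i * b i : ℤ) ≤ -1 := by
        have : (∑ i, a i * b i : ℤ) < 0 := by exact_mod_cast hneg
        omega
      exact_mod_cast this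
    nlinarith
  intro x hx
  change -1 ≤ x ⬝ᵥ _
  rw [dotProduct_smul, smul_eq_mul]
  linarith [mul_nonneg hs (key x hx)]

lemma projInit_mem_polarDual {k : ℕ} {T : Set (Fin (k+1) → ℝ)} {y : Fin (k+1) → ℝ}
    (hy : y ∈ polarDual T) :
    projInit y ∈ polarDual (projInit '' (T ∩ {x | lastCoord x = 0})) := by
  rintro _ ⟨x, ⟨hx, hx0⟩, rfl⟩
  have h := hy x hx
  have h0 : x (Fin.last k) = 0 := hx0
  rw [Fin.sum_univ_castSucc, h0] at h
  simpa [projInit] using h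

/-- A top has a point of height at least one. -/
lemma IsTopPoly.exists_one_le_last {k : ℕ} {T : Set (Fin (k+1) → ℝ)} (h : IsTopPoly T) :
    ∃ x ∈ T, 1 ≤ x (Fin.last k) := by
  obtain ⟨V, hV, hTV⟩ := h.poly
  obtain ⟨N, -, hTN⟩ := h.facets
  by_contra! hlt
  have hle : ∀ v ∈ V, v (Fin.last k) ≤ 0 := by
    intro v hv
    have := hlt v (hTV ▸ subset_convexHull ℝ _ hv)
    obtain ⟨m, hm⟩ := hV v hv (Fin.last k)
    rw [hm] at this ⊢
    have h1 : m < 1 := by exact_mod_cast this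
    exact_mod_cast (by omega : m ≤ 0)
  set A := ∑ n ∈ N, |n (Fin.last k)|
  have hA : 0 ≤ A := Finset.sum_nonneg fun _ _ => abs_nonneg _
  have hmem : Pi.single (Fin.last k) (1 / (1 + A)) ∈ T := by
    rw [hTN]
    refine ⟨by simp [lastCoord]; positivity, ?_⟩
    simp only [Set.mem_iInter]
    intro n hn
    change -1 ≤ n ⬝ᵥ _
    have h1 : |n (Fin.last k)| ≤ A :=
      Finset.single_le_sum (f := fun n : Fin (k+1) → ℝ => |n (Fin.last k)|)
        (fun _ _ => abs_nonneg _) hn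
    rw [dotProduct_single, mul_one_div, le_div_iff₀ (by positivity)]
    linarith [neg_abs_le (n (Fin.last k))]
  rw [hTV] at hmem
  have := convexHull_subset_le_dotProduct (y := -Pi.single (Fin.last k) 1) (c := 0)
    (fun v hv => by simpa using hle v hv) _ hmem
  have hp : 0 < 1 / (1 + A) := by positivity
  simp at this
  simp at hp
  linarith

lemma eventually_add_smul_mem_of_mem_intrinsicInterior {E : Type*} [NormedAddCommGroup E]
    [NormedSpace ℝ E] {F : Set E} {w d : E} (hw : w ∈ intrinsicInterior ℝ F)
    (hd : d ∈ (affineSpan ℝ F).direction) : ∃ ε : ℝ, 0 < ε ∧ w + ε • d ∈ F ∧ w + (-ε) • d ∈ F := by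
  obtain ⟨p, hp, rfl⟩ := hw
  have hmem (t : ℝ) : (p : E) + t • d ∈ affineSpan ℝ F := by
    rw [add_comm]
    exact AffineSubspace.vadd_mem_of_mem_direction (Submodule.smul_mem _ t hd) p.2
  let g : ℝ → affineSpan ℝ F := fun t => ⟨p + t • d, hmem t⟩
  have hg : Continuous g := by
    apply Continuous.subtype_mk
    fun_prop
  have h0 : g 0 = p := Subtype.ext (by simp [g])
  have hopen : IsOpen (g ⁻¹' interior ((↑) ⁻¹' F : Set (affineSpan ℝ F))) :=
    isOpen_interior.preimage hg
  obtain ⟨δ, hδ, hball⟩ := Metric.isOpen_iff.1 hopen 0 (by simpa [h0] using hp)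
  have hin (t : ℝ) (ht : |t| < δ) : (p : E) + t • d ∈ F := by
    have : g t ∈ interior ((↑) ⁻¹' F : Set (affineSpan ℝ F)) := hball (by simpa using ht)
    exact Set.mem_preimage.1 (interior_subset (s := ((↑) ⁻¹' F : Set (affineSpan ℝ F))) this)
  refine ⟨δ / 2, by positivity, hin _ ?_, hin _ ?_⟩
  · rw [abs_of_pos (by positivity)]; linarith
  · rw [abs_neg, abs_of_pos (by positivity)]; linarith

lemma eq_and_eq_of_convex_combination_eq {α β x y c : ℝ} (hα : 0 < α) (hβ : 0 < β)
    (hαβ : α + β = 1) (hx : c ≤ x) (hy : c ≤ y) (h : α * x + β * y = c) : x = c ∧ y = c := by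
  have hsum : α * (x - c) + β * (y - c) = 0 := by linear_combination h - c * hαβ
  have h1 := mul_nonneg hα.le (sub_nonneg.2 hx)
  have h2 := mul_nonneg hβ.le (sub_nonneg.2 hy)
  have h3 : α * (x - c) = 0 := by linarith
  have h4 : β * (y - c) = 0 := by linarith
  exact ⟨sub_eq_zero.1 ((mul_eq_zero.1 h3).resolve_left hα.ne'),
    sub_eq_zero.1 ((mul_eq_zero.1 h4).resolve_left hβ.ne')⟩

lemma projInit_negE_add_smul {k : ℕ} (d : Fin (k+1) → ℝ) (t : ℝ) :
    projInit (negE k + t • d) = t • projInit d := by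
  ext i
  simp [projInit, negE, (Fin.castSucc_lt_last i).ne]

/-- On each side of `negE k`, an edge of the dual of a top has exactly one lattice point. -/
lemma exists_unique_isLatticePt_add_smul {k : ℕ} {T F : Set (Fin (k+1) → ℝ)} (hT : IsTopPoly T)
    {n : Fin (k+1) → ℝ} {c : ℝ} (hc : ∀ x ∈ polarDual T, c ≤ ∑ i, n i * x i)
    (hF : F = {x ∈ polarDual T | ∑ i, n i * x i = c}) {d : Fin (k+1) → ℝ}
    (hd : projInit d ≠ 0) (hline : ∀ x ∈ F, ∃ t : ℝ, x = negE k + t • d) {ε : ℝ} (hε : 0 < ε)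
    (hεF : negE k + ε • d ∈ F) :
    ∃ b : ℝ, 0 < b ∧ negE k + b • d ∈ latticePts F ∧
      ∀ t : ℝ, 0 < t → negE k + t • d ∈ latticePts F → t = b := by
  obtain ⟨N, hN, hTN⟩ := hT.facets
  have hFT : F ⊆ polarDual T := by rw [hF]; exact Set.sep_subset _ _
  have hclosed : IsClosed F := by
    rw [hF]
    exact (isClosed_polarDual T).inter (isClosed_eq (by fun_prop) continuous_const)
  set I : Set ℝ := {t | negE k + t • d ∈ F} with hI
  have hIclosed : IsClosed I := hclosed.preimage (by fun_prop)
  have hd' : 0 < ‖projInit d‖ := norm_pos_iff.2 hd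
  have hproj (t : ℝ) (ht : t ∈ I) :
      t • projInit d ∈ polarDual (projInit '' (T ∩ {x | lastCoord x = 0})) := by
    rw [← projInit_negE_add_smul]
    exact projInit_mem_polarDual (hFT ht)
  have hIbdd : BddAbove I := by
    obtain ⟨W, -, hW⟩ := hT.reflexive_boundary.2.2
    obtain ⟨R, hR⟩ := (W.finite_toSet.isCompact_convexHull ℝ).isBounded.exists_norm_le
    refine ⟨R / ‖projInit d‖, fun t ht => ?_⟩
    have := hR _ (hW ▸ hproj t ht)
    rw [norm_smul, Real.norm_eq_abs] at this
    rw [le_div_iff₀ hd']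
    exact (mul_le_mul_of_nonneg_right (le_abs_self t) hd'.le).trans this
  set b := sSup I
  have hbI : b ∈ I := hIclosed.csSup_mem ⟨ε, hεF⟩ hIbdd
  have hmax (t : ℝ) (ht : t ∈ I) : t ≤ b := le_csSup hIbdd ht
  have hb0 : 0 < b := hε.trans_le (hmax ε hεF)
  have hinj (s t : ℝ) (hst : negE k + s • d = negE k + t • d) : s = t := by
    have hd0 : d ≠ 0 := by rintro rfl; exact hd (by ext; simp [projInit])
    exact smul_left_injective ℝ hd0 (add_left_cancel hst)
  have hext : negE k + b • d ∈ (polarDual T).extremePoints ℝ := by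
    refine mem_extremePoints.2 ⟨hFT hbI, fun x hx y hy hxy => ?_⟩
    obtain ⟨α, β, hα, hβ, hαβ, hsum⟩ := hxy
    have hval : n ⬝ᵥ (negE k + b • d) = c := by
      have := hbI
      rw [hI, Set.mem_ofPred_eq, hF] at this
      exact this.2
    have hx1 : c ≤ n ⬝ᵥ x := hc x hx
    have hy1 : c ≤ n ⬝ᵥ y := hc y hy
    rw [← hsum, dotProduct_add, dotProduct_smul, dotProduct_smul, smul_eq_mul, smul_eq_mul]
      at hval
    obtain ⟨hxc, hyc⟩ := eq_and_eq_of_convex_combination_eq hα hβ hαβ hx1 hy1 hval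
    have hxF : x ∈ F := by rw [hF]; exact ⟨hx, hxc⟩
    have hyF : y ∈ F := by rw [hF]; exact ⟨hy, hyc⟩
    obtain ⟨s, rfl⟩ := hline x hxF
    obtain ⟨t, rfl⟩ := hline y hyF
    have hst : α * s + β * t = b := by
      apply hinj
      rw [← hsum]
      have : β = 1 - α := by linarith
      subst this
      module
    have hs := hmax s hxF
    have ht := hmax t hyF
    obtain ⟨hsb, htb⟩ := eq_and_eq_of_convex_combination_eq hα hβ hαβ (neg_le_neg hs)
      (neg_le_neg ht) (by linarith)
    rw [neg_inj.1 hsb, neg_inj.1 htb]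
    exact ⟨rfl, rfl⟩
  refine ⟨b, hb0, ⟨hbI, isLatticePt_of_mem_extremePoints_polarDual hN hTN hext⟩, ?_⟩
  rintro t ht ⟨htF, htl⟩
  refine le_antisymm (hmax t htF) (not_lt.1 fun hlt => ?_)
  have hlat : IsLatticePt (t • projInit d) := by
    rw [← projInit_negE_add_smul]
    exact fun i => htl i.castSucc
  have := eq_zero_of_isLatticePt_of_smul_mem_polarDual hT.reflexive_boundary hlat
    (c := b / t) ((one_lt_div ht).2 hlt)
    (by rw [smul_smul, div_mul_cancel₀ _ ht.ne']; exact hproj b hbI)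
  exact (smul_ne_zero ht.ne' hd) this

lemma isLatticePt_negE (k : ℕ) : IsLatticePt (negE k) := by
  intro i
  by_cases hi : i = Fin.last k
  · exact ⟨-1, by simp [negE, hi]⟩
  · exact ⟨0, by simp [negE, hi]⟩

lemma IsTopPoly.projInit_ne_zero {k : ℕ} {T : Set (Fin (k+1) → ℝ)} (hT : IsTopPoly T)
    {d : Fin (k+1) → ℝ} (hd : d ≠ 0) {ε : ℝ} (hε : 0 < ε)
    (hpos : negE k + ε • d ∈ polarDual T) (hneg : negE k + (-ε) • d ∈ polarDual T) :
    projInit d ≠ 0 := by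
  intro h0
  obtain ⟨x, hx, hx1⟩ := hT.exists_one_le_last
  have hi (i : Fin k) : d i.castSucc = 0 := congrFun h0 i
  have h1 := hpos x hx
  have h2 := hneg x hx
  rw [Fin.sum_univ_castSucc] at h1 h2
  simp [negE, hi, (Fin.castSucc_lt_last _).ne] at h1 h2
  have hl : d (Fin.last k) = 0 := by
    have hx2 : x (Fin.last k) = 1 := by linarith
    rw [hx2] at h1 h2
    have : ε * d (Fin.last k) = 0 := by linarith
    exact (mul_eq_zero.1 this).resolve_left hε.ne'
  exact hd (funext fun i => Fin.lastCases hl hi i)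

/-- In the polar dual of a four-dimensional short top, any edge containing
`(0,0,0,-1)` in its (relative) interior contains exactly 3 lattice points. -/
theorem stmt18 (T : Set (Fin (3+1) → ℝ)) (h : IsShortTop T)
    (F : Set (Fin (3+1) → ℝ)) (hF : IsFace (polarDual T) F 1)
    (hw : negE 3 ∈ intrinsicInterior ℝ F) :
    (latticePts F).ncard = 3 := by
  obtain ⟨n, c, -, hc, hFeq, hdim⟩ := hF
  obtain ⟨d, hd0, hspan⟩ := finrank_eq_one_iff'.1 hdim
  have hFT : F ⊆ polarDual T := by rw [hFeq]; exact Set.sep_subset _ _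
  have hwF : negE 3 ∈ F := intrinsicInterior_subset hw
  obtain ⟨ε, hε, hpos, hneg⟩ := eventually_add_smul_mem_of_mem_intrinsicInterior hw d.2
  have hd : (d : Fin (3+1) → ℝ) ≠ 0 := fun h => hd0 (Subtype.ext h)
  have hproj := h.1.projInit_ne_zero hd hε (hFT hpos) (hFT hneg)
  have hline : ∀ x ∈ F, ∃ t : ℝ, x = negE 3 + t • (d : Fin (3+1) → ℝ) := by
    intro x hx
    obtain ⟨t, ht⟩ := hspan ⟨x -ᵥ negE 3, AffineSubspace.vsub_mem_direction
      (subset_affineSpan ℝ F hx) (subset_affineSpan ℝ F hwF)⟩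
    refine ⟨t, ?_⟩
    have : t • (d : Fin (3+1) → ℝ) = x - negE 3 := congrArg Subtype.val ht
    rw [this, add_sub_cancel]
  obtain ⟨b, hb, hbF, hbu⟩ :=
    exists_unique_isLatticePt_add_smul h.1 hc hFeq hproj hline hε hpos
  obtain ⟨a, ha, haF, hau⟩ := exists_unique_isLatticePt_add_smul h.1 hc hFeq
    (d := -(d : Fin (3+1) → ℝ))
    (fun h0 => hproj (funext fun i => neg_eq_zero.1 (congrFun h0 i)))
    (fun x hx => by
      obtain ⟨t, rfl⟩ := hline x hx
      exact ⟨-t, by simp⟩) hε (by simpa using hneg)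
  rw [Set.ncard_eq_three]
  refine ⟨negE 3, negE 3 + b • (d : Fin (3+1) → ℝ), negE 3 + a • -(d : Fin (3+1) → ℝ),
    ?_, ?_, ?_, ?_⟩
  · simp [hb.ne', hd]
  · simp [ha.ne', hd]
  · intro heq
    have h1 : b • (d : Fin (3+1) → ℝ) = (-a) • (d : Fin (3+1) → ℝ) := by
      simpa using heq
    have := smul_left_injective ℝ hd h1
    linarith
  · ext x
    simp only [Set.mem_insert_iff, Set.mem_singleton_iff]
    constructor
    · intro hx
      obtain ⟨t, rfl⟩ := hline x hx.1
      rcases lt_trichotomy t 0 with ht | rfl | ht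
      · have := hau (-t) (by linarith) (by simpa using hx)
        right; right
        rw [← this]; simp
      · simp
      · right; left
        rw [hbu t ht hx]
    · rintro (rfl | rfl | rfl)
      · exact ⟨hwF, isLatticePt_negE 3⟩
      · exact hbF
      · exact haF

end SemistableTops
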